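/- arXiv:math/0703788 — 2 statements merged into one kernel-verified Lean document; each statement's English description precedes it below -/
import Mathlib

section
/- For every z ∈ ℂ with −1 < Re z < 0: the improper integral representation ζ(z) = z·∫_0^∞ (⌊x⌋ − x + 1/2)·x^{−z−1} dx holds, in the sense that z·∫_0^X (⌊x⌋ − x + 1/2)·x^{−z−1} dx tends to ζ(z) as X → ∞ (the integrand being absolutely integrable on (0,X) for every X > 0). (Formula (3) of the paper's Example 3.26.1.) -/
open MeasureTheory Set Filter Complex

noncomputable def zsW (x : ℝ) : ℝ := (⌊x⌋ : ℤ) - x + 1 / 2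

noncomputable def zsP (x : ℝ) : ℝ := Int.fract x * (1 - Int.fract x) / 2

lemma zsW_meas : Measurable zsW := by
  unfold zsW
  have : Measurable (fun x : ℝ => ((⌊x⌋ : ℤ) : ℝ)) :=
    (measurable_from_top (f := fun n : ℤ => (n : ℝ))).comp Int.measurable_floor
  fun_prop

lemma zsW_bound (x : ℝ) : ‖(zsW x : ℂ)‖ ≤ 1 := by
  rw [Complex.norm_real, Real.norm_eq_abs, abs_le, zsW]
  have h1 := Int.floor_le x
  have h2 := Int.lt_floor_add_one x
  constructor <;> linarith

lemma zsP_cont : Continuous zsP := by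
  have : Continuous ((fun x : ℝ => x * (1 - x) / 2) ∘ Int.fract) := by
    apply ContinuousOn.comp_fract''
    · fun_prop
    · norm_num
  exact this

lemma zsP_bound (x : ℝ) : ‖(zsP x : ℂ)‖ ≤ 1 := by
  rw [Complex.norm_real, Real.norm_eq_abs, abs_le, zsP]
  have h1 := Int.fract_nonneg x
  have h2 := Int.fract_lt_one x
  constructor <;> nlinarith

lemma zsP_one : zsP 1 = 0 := by simp [zsP]

lemma zsP_deriv {x : ℝ} (hx : x ∉ range (fun n : ℤ => (n : ℝ))) :
    HasDerivAt zsP (zsW x) x := by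
  have hlt : (⌊x⌋ : ℝ) < x :=
    lt_of_le_of_ne (Int.floor_le x) (fun h => hx ⟨⌊x⌋, h⟩)
  have h2 := Int.lt_floor_add_one x
  have h : HasDerivAt (fun y : ℝ => (y - ⌊x⌋) * (1 - (y - ⌊x⌋)) / 2) (zsW x) x := by
    have ha : HasDerivAt (fun y : ℝ => y - (⌊x⌋ : ℝ)) 1 x := (hasDerivAt_id x).sub_const _
    convert! (ha.mul (ha.const_sub 1)).div_const 2 using 1
    unfold zsW
    ring
  refine h.congr_of_eventuallyEq ?_
  filter_upwards [Ioo_mem_nhds hlt h2] with y hy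
  have : ⌊y⌋ = ⌊x⌋ := Int.floor_eq_iff.2 ⟨hy.1.le, hy.2⟩
  simp only [zsP, Int.fract, this]

lemma zs_integrableOn_W {s : Set ℝ} {a : ℂ}
    (h : IntegrableOn (fun x : ℝ => (x : ℂ) ^ a) s) :
    IntegrableOn (fun x : ℝ => (zsW x : ℂ) * (x : ℂ) ^ a) s :=
  Integrable.bdd_mul (c := 1) h
    (Complex.measurable_ofReal.comp zsW_meas).aestronglyMeasurable
    (Eventually.of_forall zsW_bound)

lemma zs_integrableOn_P {s : Set ℝ} {a : ℂ}
    (h : IntegrableOn (fun x : ℝ => (x : ℂ) ^ a) s) :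
    IntegrableOn (fun x : ℝ => (zsP x : ℂ) * (x : ℂ) ^ a) s :=
  Integrable.bdd_mul (c := 1) h
    (Complex.continuous_ofReal.comp zsP_cont).aestronglyMeasurable
    (Eventually.of_forall zsP_bound)

lemma zs_cpow_int {X : ℝ} (hX : 1 ≤ X) (a : ℂ) :
    IntegrableOn (fun x : ℝ => (x : ℂ) ^ a) (Ioc 1 X) := by
  rw [← intervalIntegrable_iff_integrableOn_Ioc_of_le hX]
  apply intervalIntegral.intervalIntegrable_cpow
  right
  rw [uIcc_of_le hX]
  intro h
  linarith [h.1]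

/-- Integration by parts. -/
lemma zs_parts {s : ℂ} (hs : -1 < s.re) {X : ℝ} (hX : 1 ≤ X) :
    ∫ x in (1 : ℝ)..X, (zsW x : ℂ) * (x : ℂ) ^ (-s - 1) =
      (zsP X : ℂ) * (X : ℂ) ^ (-s - 1) +
        (s + 1) * ∫ x in (1 : ℝ)..X, (zsP x : ℂ) * (x : ℂ) ^ (-s - 2) := by
  have hne : -s - 1 ≠ 0 := by
    intro h
    have := congrArg Complex.re h
    simp at this
    linarith
  have i1 : IntervalIntegrable (fun x : ℝ => (zsW x : ℂ) * (x : ℂ) ^ (-s - 1)) volume 1 X := by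
    rw [intervalIntegrable_iff_integrableOn_Ioc_of_le hX]
    exact zs_integrableOn_W (zs_cpow_int hX _)
  have i2 : IntervalIntegrable (fun x : ℝ => (zsP x : ℂ) * (x : ℂ) ^ (-s - 2)) volume 1 X := by
    rw [intervalIntegrable_iff_integrableOn_Ioc_of_le hX]
    exact zs_integrableOn_P (zs_cpow_int hX _)
  have key := integral_eq_of_hasDerivAt_off_countable
    (fun x : ℝ => (zsP x : ℂ) * (x : ℂ) ^ (-s - 1))
    (fun x : ℝ => (zsW x : ℂ) * (x : ℂ) ^ (-s - 1)
      - (s + 1) * ((zsP x : ℂ) * (x : ℂ) ^ (-s - 2)))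
    (a := 1) (b := X) (s := range (fun n : ℤ => (n : ℝ))) (countable_range _)
    (by
      rw [uIcc_of_le hX]
      intro x hx
      have hx0 : x ≠ 0 := by linarith [hx.1]
      exact ((Complex.continuous_ofReal.comp zsP_cont).continuousAt.mul
        (Complex.continuousAt_ofReal_cpow_const _ _ (Or.inr hx0))).continuousWithinAt)
    (by
      rintro x ⟨hx, hxn⟩
      rw [min_eq_left hX] at hx
      have hx0 : x ≠ 0 := by linarith [hx.1]
      convert! (zsP_deriv hxn).ofReal_comp.mul (hasDerivAt_ofReal_cpow_const hx0 hne) using 1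
      rw [show -s - 1 - 1 = -s - 2 by ring]
      ring)
    (i1.sub (i2.const_mul _))
  rw [intervalIntegral.integral_sub i1 (i2.const_mul _),
    intervalIntegral.integral_const_mul, zsP_one] at key
  simp only [ofReal_zero, zero_mul, sub_zero] at key
  rw [← key]
  ring

noncomputable def zsM (s : ℂ) : ℂ := ∫ x in Ioi (1 : ℝ), (zsP x : ℂ) * (x : ℂ) ^ (-s - 2)

lemma zs_tendsto {s : ℂ} (hs : -1 < s.re) :
    Tendsto (fun X : ℝ => ∫ x in (1 : ℝ)..X, (zsW x : ℂ) * (x : ℂ) ^ (-s - 1)) atTop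
      (nhds ((s + 1) * zsM s)) := by
  have h1 : Tendsto (fun X : ℝ => (zsP X : ℂ) * (X : ℂ) ^ (-s - 1)) atTop (nhds 0) := by
    have h0 : Tendsto (fun X : ℝ => X ^ (-(s.re + 1))) atTop (nhds 0) :=
      tendsto_rpow_neg_atTop (by linarith)
    refine squeeze_zero_norm' ?_ h0
    filter_upwards [eventually_gt_atTop 0] with X hX
    rw [norm_mul, Complex.norm_cpow_eq_rpow_re_of_pos hX]
    have e : (-s - 1).re = -(s.re + 1) := by simp; ring
    rw [e]
    exact mul_le_of_le_one_left (Real.rpow_nonneg hX.le _) (zsP_bound X)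
  have h2 : Tendsto (fun X : ℝ => ∫ x in (1 : ℝ)..X, (zsP x : ℂ) * (x : ℂ) ^ (-s - 2)) atTop
      (nhds (zsM s)) := by
    refine intervalIntegral_tendsto_integral_Ioi 1 ?_ tendsto_id
    apply zs_integrableOn_P
    apply integrableOn_Ioi_cpow_of_lt _ zero_lt_one
    simp
    linarith
  have h3 := h1.add (h2.const_mul (s + 1))
  rw [zero_add] at h3
  refine h3.congr' ?_
  filter_upwards [eventually_ge_atTop 1] with X hX
  exact (zs_parts hs hX).symm

lemma zsM_diff {s : ℂ} (hs : -1 < s.re) : DifferentiableAt ℂ zsM s := by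
  have e : zsM = fun s => mellin (indicator (Ioi 1) (fun x : ℝ => (zsP x : ℂ))) (-s - 1) := by
    funext s
    rw [zsM, mellin]
    have : ∀ x : ℝ, (x : ℂ) ^ (-s - 1 - 1) • indicator (Ioi 1) (fun x : ℝ => (zsP x : ℂ)) x
        = indicator (Ioi 1) (fun x : ℝ => (zsP x : ℂ) * (x : ℂ) ^ (-s - 2)) x := by
      intro x
      by_cases hx : x ∈ Ioi (1 : ℝ)
      · simp only [indicator_of_mem hx, smul_eq_mul]
        rw [show -s - 1 - 1 = -s - 2 by ring, mul_comm]
      · simp only [indicator_of_notMem hx, smul_zero]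
    simp_rw [this]
    rw [setIntegral_indicator measurableSet_Ioi]
    congr 2
    ext x
    simp only [mem_Ioi, mem_inter_iff]
    constructor
    · intro h
      exact ⟨by linarith, h⟩
    · exact fun h => h.2
  rw [e]
  have hd : DifferentiableAt ℂ (mellin (indicator (Ioi 1) (fun x : ℝ => (zsP x : ℂ)))) (-s - 1) := by
    refine mellin_differentiableAt_of_isBigO_rpow (a := 0) (b := (-s - 1).re - 1) ?_ ?_ ?_ ?_ ?_
    · apply LocallyIntegrable.locallyIntegrableOn
      exact ((Complex.continuous_ofReal.comp zsP_cont).locallyIntegrable).indicator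
        measurableSet_Ioi
    · refine Asymptotics.IsBigO.of_bound 1 (Eventually.of_forall fun x => ?_)
      simp only [neg_zero, Real.rpow_zero, norm_one, mul_one]
      refine (norm_indicator_le_norm_self _ _).trans (zsP_bound x)
    · simp
      linarith
    · have : indicator (Ioi 1) (fun x : ℝ => (zsP x : ℂ)) =ᶠ[nhdsWithin 0 (Ioi 0)] 0 := by
        filter_upwards [mem_nhdsWithin_of_mem_nhds (Iio_mem_nhds (zero_lt_one (α := ℝ)))] with x hx
        refine indicator_of_notMem ?_ _
        simp only [mem_Ioi, mem_Iio, not_lt] at *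
        exact hx.le
      exact this.trans_isBigO (Asymptotics.isBigO_zero _ _)
    · linarith
  have hg : DifferentiableAt ℂ (fun s : ℂ => -s - 1) s := by fun_prop
  exact DifferentiableAt.comp (g := mellin (indicator (Ioi 1) (fun x : ℝ => (zsP x : ℂ))))
    (f := fun s : ℂ => -s - 1) s hd hg

/-- The formula in the half plane of absolute convergence. -/
lemma zs_half {s : ℂ} (hs : 1 < s.re) :
    riemannZeta s = (s - 1)⁻¹ + (1 / 2 + s * ((s + 1) * zsM s)) := by
  have hs0 : s ≠ 0 := by rintro rfl; norm_num at hs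
  have hs1 : s - 1 ≠ 0 := by
    intro h
    rw [sub_eq_zero.1 h] at hs
    norm_num at hs
  have i0 : IntegrableOn (fun x : ℝ => (x : ℂ) ^ (-s - 1)) (Ioi 1) :=
    integrableOn_Ioi_cpow_of_lt (by simp; linarith) zero_lt_one
  have i1 : IntegrableOn (fun x : ℝ => (x : ℂ) ^ (-s)) (Ioi 1) :=
    integrableOn_Ioi_cpow_of_lt (by simp; linarith) zero_lt_one
  have iW := zs_integrableOn_W i0
  have hlim := tendsto_nhds_unique (zs_tendsto (s := s) (by linarith))
    (intervalIntegral_tendsto_integral_Ioi 1 iW tendsto_id)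
  have hz : riemannZeta s = s * ∫ t in Ioi (1 : ℝ), ((zsW t : ℂ) * (t : ℂ) ^ (-s - 1)
      + ((t : ℂ) ^ (-s) - (1 / 2) * (t : ℂ) ^ (-s - 1))) := by
    rw [← LSeries_one_eq_riemannZeta hs, LSeries_eq_mul_integral' 1 zero_le_one hs]
    · congr 1
      refine setIntegral_congr_fun measurableSet_Ioi fun t ht => ?_
      have ht0 : (0 : ℝ) < t := zero_lt_one.trans ht
      have ht0' : (t : ℂ) ≠ 0 := by exact_mod_cast ht0.ne'
      have hfl : ((⌊t⌋₊ : ℕ) : ℂ) = ((⌊t⌋ : ℤ) : ℂ) := by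
        exact_mod_cast congrArg (fun n : ℤ => (n : ℂ)) (Int.natCast_floor_eq_floor ht0.le)
      have hp : (t : ℂ) ^ (-s) = t * (t : ℂ) ^ (-s - 1) := by
        rw [Complex.cpow_sub _ _ ht0', Complex.cpow_one]
        field_simp
      simp only [Pi.one_apply, Finset.sum_const, Nat.card_Icc, add_tsub_cancel_right,
        nsmul_eq_mul, mul_one]
      rw [hp, hfl, show -(s + 1) = -s - 1 by ring, zsW]
      push_cast
      ring
    · simp only [Pi.one_apply, norm_one, Finset.sum_const, Nat.card_Icc, add_tsub_cancel_right,
        nsmul_eq_mul, mul_one, Real.rpow_one]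
      exact Asymptotics.isBigO_refl _ _
  have i2 : IntegrableOn (fun x : ℝ => (x : ℂ) ^ (-s) - (1 / 2) * (x : ℂ) ^ (-s - 1)) (Ioi 1) :=
    i1.sub (i0.const_mul _)
  rw [hz, integral_add iW i2, integral_sub i1 (i0.const_mul _),
    integral_const_mul, ← hlim, integral_Ioi_cpow_of_lt (by simp; linarith) zero_lt_one,
    integral_Ioi_cpow_of_lt (by simp; linarith) zero_lt_one]
  simp only [ofReal_one, one_cpow]
  have e1 : -s + 1 = -(s - 1) := by ring
  have e2 : -s - 1 + 1 = -s := by ring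
  rw [e1, e2]
  field_simp
  ring

lemma zs_continued {s : ℂ} (hs : -1 < s.re) (hs1 : s ≠ 1) :
    riemannZeta s = (s - 1)⁻¹ + (1 / 2 + s * ((s + 1) * zsM s)) := by
  have hopen : IsOpen {s : ℂ | -1 < s.re} := isOpen_lt continuous_const Complex.continuous_re
  have h : EqOn riemannZeta₀ (fun s => 1 / 2 + s * ((s + 1) * zsM s)) {s : ℂ | -1 < s.re} := by
    refine AnalyticOnNhd.eqOn_of_preconnected_of_eventuallyEq (𝕜 := ℂ) (z₀ := 2) ?_ ?_ ?_ ?_ ?_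
    · exact differentiable_riemannZeta₀.differentiableOn.analyticOnNhd hopen
    · refine DifferentiableOn.analyticOnNhd (fun s hs => ?_) hopen
      have := zsM_diff hs
      apply DifferentiableAt.differentiableWithinAt
      fun_prop
    · exact (convex_halfSpace_re_gt (-1)).isPreconnected
    · simp; norm_num
    · have : {s : ℂ | 1 < s.re} ∈ nhds (2 : ℂ) :=
        (isOpen_lt continuous_const Complex.continuous_re).mem_nhds (by simp)
      filter_upwards [this] with w hw
      have hw1 : w ≠ 1 := by
        rintro rfl
        simp at hw
      have := zs_half hw
      rw [riemannZeta_eq_inv_sub_add hw1] at this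
      exact add_left_cancel this
  rw [riemannZeta_eq_inv_sub_add hs1, h hs]

lemma zs_unit {z : ℂ} (h₁ : z.re < 0) :
    z * ∫ x in (0 : ℝ)..1, (zsW x : ℂ) * (x : ℂ) ^ (-z - 1) = (z - 1)⁻¹ + 1 / 2 := by
  have hz0 : z ≠ 0 := by rintro rfl; simp at h₁
  have hz1 : z - 1 ≠ 0 := by
    intro h
    rw [sub_eq_zero.1 h] at h₁
    norm_num at h₁
  have r0 : -1 < (-z - 1).re := by simp; linarith
  have r1 : -1 < (-z).re := by simp; linarith
  have i0 : IntervalIntegrable (fun x : ℝ => (x : ℂ) ^ (-z - 1)) volume 0 1 :=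
    intervalIntegral.intervalIntegrable_cpow' r0
  have i1 : IntervalIntegrable (fun x : ℝ => (x : ℂ) ^ (-z)) volume 0 1 :=
    intervalIntegral.intervalIntegrable_cpow' r1
  have : ∫ x in (0 : ℝ)..1, (zsW x : ℂ) * (x : ℂ) ^ (-z - 1)
      = ∫ x in (0 : ℝ)..1, ((1 / 2) * (x : ℂ) ^ (-z - 1) - (x : ℂ) ^ (-z)) := by
    rw [intervalIntegral.integral_of_le zero_le_one, intervalIntegral.integral_of_le zero_le_one,
      integral_Ioc_eq_integral_Ioo, integral_Ioc_eq_integral_Ioo]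
    refine setIntegral_congr_fun measurableSet_Ioo fun t ht => ?_
    have ht0' : (t : ℂ) ≠ 0 := by exact_mod_cast ht.1.ne'
    have hfl : ⌊t⌋ = 0 := Int.floor_eq_zero_iff.2 ⟨ht.1.le, ht.2⟩
    have hp : (t : ℂ) ^ (-z) = t * (t : ℂ) ^ (-z - 1) := by
      rw [Complex.cpow_sub _ _ ht0', Complex.cpow_one]
      field_simp
    simp only [zsW, hfl, hp]
    push_cast
    ring
  rw [this, intervalIntegral.integral_sub (i0.const_mul _) i1,
    intervalIntegral.integral_const_mul, integral_cpow (Or.inl r0), integral_cpow (Or.inl r1)]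
  have e1 : -z + 1 = -(z - 1) := by ring
  have e2 : -z - 1 + 1 = -z := by ring
  rw [e1, e2]
  simp only [ofReal_one, one_cpow, ofReal_zero]
  rw [Complex.zero_cpow (neg_ne_zero.2 hz0), Complex.zero_cpow (neg_ne_zero.2 hz1)]
  field_simp
  ring

/-- Improper-integral representation of `ζ` in the strip `−1 < Re z < 0`
(Formula (3) of the paper's Example 3.26.1). -/
theorem zeta_integral_repr_strip (z : ℂ) (h₀ : -1 < z.re) (h₁ : z.re < 0) :
    (∀ X : ℝ, 0 < X →
      IntegrableOn
        (fun x : ℝ => (((⌊x⌋ : ℤ) - x + 1 / 2 : ℝ) : ℂ) * (x : ℂ) ^ (-z - 1))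
        (Ioc 0 X)) ∧
    Tendsto
      (fun X : ℝ =>
        z * ∫ x in Ioc (0 : ℝ) X,
          (((⌊x⌋ : ℤ) - x + 1 / 2 : ℝ) : ℂ) * (x : ℂ) ^ (-z - 1))
      atTop (nhds (riemannZeta z)) := by
  have r0 : -1 < (-z - 1).re := by simp; linarith
  have hint : ∀ X : ℝ, 0 < X →
      IntegrableOn (fun x : ℝ => (zsW x : ℂ) * (x : ℂ) ^ (-z - 1)) (Ioc 0 X) := by
    intro X hX
    apply zs_integrableOn_W
    rw [← intervalIntegrable_iff_integrableOn_Ioc_of_le hX.le]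
    exact intervalIntegral.intervalIntegrable_cpow' r0
  refine ⟨hint, ?_⟩
  have hz1 : z ≠ 1 := by
    rintro rfl
    norm_num at h₁
  have hlim := ((zs_tendsto h₀).const_mul z).const_add ((z - 1)⁻¹ + 1 / 2)
  rw [add_assoc, ← zs_continued h₀ hz1] at hlim
  refine hlim.congr' ?_
  filter_upwards [eventually_ge_atTop 1] with X hX
  have hX0 : (0 : ℝ) < X := by linarith
  change _ = z * ∫ x in Ioc (0 : ℝ) X, (zsW x : ℂ) * (x : ℂ) ^ (-z - 1)
  rw [← zs_unit h₁, ← mul_add, ← intervalIntegral.integral_of_le hX0.le,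
    intervalIntegral.integral_add_adjacent_intervals]
  · rw [intervalIntegrable_iff_integrableOn_Ioc_of_le zero_le_one]
    exact hint 1 one_pos
  · rw [intervalIntegrable_iff_integrableOn_Ioc_of_le hX]
    exact zs_integrableOn_W (zs_cpow_int hX _)
end

section
/- For every z ∈ ℂ with 0 < Re z < 1: ζ(z) = −(sin(π·z)/π)·∫_0^∞ (Γ'(1+x)/Γ(1+x) − ln x)·x^{−z} dx, where Γ is the real Gamma function, Γ'(1+x)/Γ(1+x) is its logarithmic derivative (the digamma function evaluated at 1 + x) and the integral is absolutely convergent. (Formula (2) of the paper's Example 3.26.2, representing ζ as a Mellin-type transform of ψ(1+x) − ln x.) -/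
open MeasureTheory Set Complex

/-- The kernel `1/t - 1/(e^t - 1)`. -/
noncomputable def phiK (t : ℝ) : ℝ := t⁻¹ - (Real.exp t - 1)⁻¹

lemma exp_sub_one_pos' {t : ℝ} (ht : 0 < t) : 0 < Real.exp t - 1 := by
  have := Real.add_one_lt_exp ht.ne'
  linarith

lemma phiK_nonneg {t : ℝ} (ht : 0 < t) : 0 ≤ phiK t := by
  have := Real.add_one_le_exp t
  unfold phiK
  rw [sub_nonneg]
  exact inv_anti₀ ht (by linarith)

lemma phiK_le_inv {t : ℝ} (ht : 0 < t) : phiK t ≤ t⁻¹ := by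
  have := inv_pos.2 (exp_sub_one_pos' ht)
  unfold phiK
  linarith

lemma phiK_le_one {t : ℝ} (ht : 0 < t) : phiK t ≤ 1 := by
  have h1 := exp_sub_one_pos' ht
  have h2 : Real.exp t * (1 - t) ≤ 1 := by
    have h3 : 1 - t ≤ Real.exp (-t) := by linarith [Real.add_one_le_exp (-t)]
    calc Real.exp t * (1 - t) ≤ Real.exp t * Real.exp (-t) := by gcongr
      _ = 1 := by rw [← Real.exp_add]; simp
  unfold phiK
  rw [inv_eq_one_div, inv_eq_one_div, div_sub_div _ _ ht.ne' h1.ne', div_le_one (by positivity)]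
  nlinarith

lemma continuousOn_phiK : ContinuousOn phiK (Ioi 0) := by
  unfold phiK
  refine ContinuousOn.sub (continuousOn_id.inv₀ fun t ht => (ne_of_gt ht)) ?_
  exact ContinuousOn.inv₀ (by fun_prop) fun t ht => (exp_sub_one_pos' ht).ne'

lemma integrableOn_phiK_exp {x : ℝ} (hx : 0 < x) :
    IntegrableOn (fun t => phiK t * Real.exp (-x * t)) (Ioi 0) := by
  refine Integrable.mono' (integrableOn_exp_mul_Ioi (neg_lt_zero.2 hx) 0) ?_ ?_
  · exact (continuousOn_phiK.mul (by fun_prop)).aestronglyMeasurable measurableSet_Ioi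
  · filter_upwards [ae_restrict_mem measurableSet_Ioi] with t ht
    have h0 := phiK_nonneg ht
    have h1 := phiK_le_one ht
    rw [Real.norm_of_nonneg (by positivity)]
    nlinarith [Real.exp_pos (-x * t)]

noncomputable def lapG (x : ℝ) : ℝ := ∫ t in Ioi (0 : ℝ), phiK t * Real.exp (-x * t)

lemma lapG_nonneg (x : ℝ) : 0 ≤ lapG x := by
  refine setIntegral_nonneg measurableSet_Ioi fun t ht => ?_
  have h0 := phiK_nonneg ht
  positivity

lemma lapG_le {x : ℝ} (hx : 0 < x) : lapG x ≤ 1 / x := by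
  have h := integral_exp_mul_Ioi (neg_lt_zero.2 hx) 0
  have : (1 : ℝ) / x = ∫ t in Ioi (0 : ℝ), Real.exp (-x * t) := by
    rw [h]; simp
  rw [this]
  refine setIntegral_mono_on (integrableOn_phiK_exp hx)
    (integrableOn_exp_mul_Ioi (neg_lt_zero.2 hx) 0) measurableSet_Ioi fun t ht => ?_
  have h1 := phiK_le_one ht
  nlinarith [Real.exp_pos (-x * t)]

lemma lapG_diff {x : ℝ} (hx : 0 < x) :
    lapG x - lapG (x + 1) = Real.log (x + 1) - Real.log x - 1 / (x + 1) := by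
  have hx1 : 0 < x + 1 := by linarith
  have hi := integrableOn_phiK_exp hx
  have hi1 := integrableOn_phiK_exp hx1
  have hie := integrableOn_exp_mul_Ioi (neg_lt_zero.2 hx1) 0
  have hsub : IntegrableOn (fun t => phiK t * Real.exp (-x * t) -
      phiK t * Real.exp (-(x + 1) * t)) (Ioi 0) := hi.sub hi1
  have key : ∀ t ∈ Ioi (0 : ℝ), t⁻¹ • (Real.exp (-(x * t)) - Real.exp (-((x + 1) * t))) =
      (phiK t * Real.exp (-x * t) - phiK t * Real.exp (-(x + 1) * t))
        + Real.exp (-(x + 1) * t) := by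
    intro t ht
    have h1 := exp_sub_one_pos' ht
    have ht' : t ≠ 0 := ne_of_gt ht
    have e : Real.exp (-(x * t)) = Real.exp t * Real.exp (-((x + 1) * t)) := by
      rw [← Real.exp_add]; congr 1; ring
    unfold phiK
    rw [neg_mul, neg_mul, e, smul_eq_mul]
    field_simp
    ring
  have hint : IntegrableOn
      (fun t => t⁻¹ • (Real.exp (-(x * t)) - Real.exp (-((x + 1) * t)))) (Ioi 0) :=
    ((hi.sub hi1).add hie).congr_fun (fun t ht => (key t ht).symm) measurableSet_Ioi
  have hfr := Frullani.integral_Ioi_eq (f := fun y : ℝ => Real.exp (-y)) (L := 1) (R := 0)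
    ((by fun_prop : Continuous fun y : ℝ => Real.exp (-y)).continuousOn.locallyIntegrableOn
      measurableSet_Ioi) hx hx1
    (by
      have : Filter.Tendsto (fun y : ℝ => Real.exp (-y)) (nhds 0) (nhds (Real.exp (-0))) :=
        (by fun_prop : Continuous fun y : ℝ => Real.exp (-y)).tendsto 0
      simp only [neg_zero, Real.exp_zero] at this
      exact this.mono_left nhdsWithin_le_nhds)
    (Real.tendsto_exp_neg_atTop_nhds_zero) hint
  rw [setIntegral_congr_fun measurableSet_Ioi key, integral_add hsub hie,
    integral_sub hi hi1, integral_exp_mul_Ioi (neg_lt_zero.2 hx1) 0,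
    Real.log_div hx1.ne' hx.ne'] at hfr
  simp only [mul_zero, Real.exp_zero, sub_zero, smul_eq_mul, mul_one, neg_div_neg_eq] at hfr
  unfold lapG
  linarith

noncomputable def digD (x : ℝ) : ℝ :=
  deriv Real.Gamma (1 + x) / Real.Gamma (1 + x) - Real.log x

lemma digD_props {x : ℝ} (hx : 0 < x) :
    0 ≤ digD x ∧ digD x ≤ Real.log (x + 1) - Real.log x ∧
      digD x - digD (x + 1) = Real.log (x + 1) - Real.log x - 1 / (x + 1) := by
  let f := Real.log ∘ Real.Gamma
  have hc : ConvexOn ℝ (Ioi 0) f := Real.convexOn_log_Gamma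
  have h_rec (x : ℝ) (hx : 0 < x) : f (x + 1) = f x + Real.log x := by
    simp only [f, Function.comp_apply,
      Real.Gamma_add_one hx.ne', Real.log_mul hx.ne' (Real.Gamma_pos_of_pos hx).ne', add_comm]
  have hdG {x : ℝ} (hx : 0 < x) : DifferentiableAt ℝ Real.Gamma x := by
    refine Real.differentiableAt_Gamma ?_
    intro m
    have : (0 : ℝ) ≤ m := m.cast_nonneg
    exact ne_of_gt (by linarith)
  have hder {x : ℝ} (hx : 0 < x) : DifferentiableAt ℝ f x :=
    (hdG hx).log (Real.Gamma_pos_of_pos hx).ne'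
  have hdf {x : ℝ} (hx : 0 < x) : deriv Real.Gamma x / Real.Gamma x = deriv f x := by
    simp only [f, Function.comp_def]
    rw [deriv.log (hdG hx) (Real.Gamma_pos_of_pos hx).ne']
  have hder_rec (x : ℝ) (hx : 0 < x) : deriv f (x + 1) = deriv f x + 1 / x := by
    rw [← deriv_comp_add_const, one_div, ← Real.deriv_log,
      ← deriv_add (hder <| by positivity) (Real.differentiableAt_log hx.ne')]
    apply Filter.EventuallyEq.deriv_eq
    filter_upwards [eventually_gt_nhds hx] using h_rec
  have hx1 : 0 < x + 1 := by linarith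
  have hx2 : 0 < x + 1 + 1 := by linarith
  have derivLB : Real.log x ≤ deriv f (x + 1) := by
    refine (le_of_eq ?_).trans <| hc.slope_le_deriv (mem_Ioi.mpr hx) (mem_Ioi.mpr hx1)
      (by linarith) (hder hx1)
    rw [slope_def_field, h_rec x hx]
    simp
  have derivUB : deriv f (x + 1) ≤ Real.log (x + 1) := by
    refine (hc.deriv_le_slope (mem_Ioi.mpr hx1) (mem_Ioi.mpr hx2)
        (by linarith) (hder hx1)).trans (le_of_eq ?_)
    rw [slope_def_field, h_rec _ hx1]
    simp
  unfold digD
  rw [add_comm 1 x, add_comm 1 (x + 1), hdf hx1, hdf hx2, hder_rec _ hx1]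
  refine ⟨by linarith, by linarith, by ring⟩

lemma digD_eq_lapG {x : ℝ} (hx : 0 < x) : digD x = lapG x := by
  have hper (n : ℕ) : digD (x + n) - lapG (x + n) = digD x - lapG x := by
    induction n with
    | zero => simp
    | succ n ih =>
      have hp : 0 < x + n := by positivity
      have h1 := (digD_props hp).2.2
      have h2 := lapG_diff hp
      push_cast
      rw [← add_assoc, ← ih]
      linarith
  have hb (n : ℕ) : |digD x - lapG x| ≤ 1 / (x + n) := by
    have hp : 0 < x + n := by positivity
    rw [← hper n]
    obtain ⟨h1, h2, -⟩ := digD_props hp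
    have h3 := lapG_nonneg (x + n)
    have h4 := lapG_le hp
    have h5 : Real.log (x + n + 1) - Real.log (x + n) ≤ 1 / (x + n) := by
      rw [← Real.log_div (by positivity) hp.ne']
      have := Real.log_le_sub_one_of_pos (x := (x + n + 1) / (x + n)) (by positivity)
      refine this.trans (le_of_eq ?_)
      field_simp
      ring
    rw [abs_le]
    constructor <;> linarith
  have ht : Filter.Tendsto (fun n : ℕ => 1 / (x + n)) Filter.atTop (nhds 0) := by
    simp_rw [one_div]
    exact (Filter.tendsto_atTop_add_const_left _ x tendsto_natCast_atTop_atTop).inv_tendsto_atTop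
  have := ge_of_tendsto' ht hb
  have := abs_nonpos_iff.1 this
  linarith

noncomputable def auxF (t : ℝ) : ℂ :=
  ((Real.exp t - 1)⁻¹ : ℝ) - indicator (Ioc 0 1) (fun t : ℝ => (t : ℂ) ^ (-1 : ℂ)) t

lemma continuousOn_bose : ContinuousOn (fun t : ℝ => (((Real.exp t - 1)⁻¹ : ℝ) : ℂ)) (Ioi 0) := by
  refine Complex.continuous_ofReal.comp_continuousOn ?_
  exact ContinuousOn.inv₀ (by fun_prop) fun t ht => (exp_sub_one_pos' ht).ne'

lemma continuousOn_cpow_neg_one :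
    ContinuousOn (fun t : ℝ => (t : ℂ) ^ (-1 : ℂ)) (Ioi 0) := fun t ht =>
  (Complex.continuousAt_ofReal_cpow_const _ _ (Or.inr (ne_of_gt ht))).continuousWithinAt

lemma locInt_auxF : LocallyIntegrableOn auxF (Ioi 0) := by
  refine LocallyIntegrableOn.sub (continuousOn_bose.locallyIntegrableOn measurableSet_Ioi) ?_
  have h := continuousOn_cpow_neg_one.locallyIntegrableOn (μ := volume) measurableSet_Ioi
  intro x hx
  obtain ⟨s, hs, hi⟩ := h x hx
  exact ⟨s, hs, hi.indicator measurableSet_Ioc⟩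

lemma auxF_top : auxF =O[Filter.atTop] fun t => Real.exp (-1 * t) := by
  refine Asymptotics.IsBigO.of_bound 2 ?_
  filter_upwards [Filter.eventually_gt_atTop 1] with t ht
  have h1 : 2 ≤ Real.exp t := by linarith [Real.add_one_le_exp t]
  have : t ∉ Ioc (0 : ℝ) 1 := fun h => by linarith [h.2]
  simp only [auxF, indicator_of_notMem this, sub_zero]
  rw [Complex.norm_real, Real.norm_of_nonneg (inv_nonneg.2 (by linarith)),
    Real.norm_of_nonneg (Real.exp_pos _).le, neg_one_mul, Real.exp_neg, ← div_eq_mul_inv,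
    inv_eq_one_div, div_le_div_iff₀ (by linarith) (by linarith)]
  linarith

lemma auxF_eq {t : ℝ} (ht : t ∈ Ioc (0 : ℝ) 1) : auxF t = -(phiK t : ℂ) := by
  simp only [auxF, indicator_of_mem ht, phiK, cpow_neg_one]
  push_cast
  ring

lemma auxF_bot : auxF =O[nhdsWithin 0 (Ioi 0)] fun t : ℝ => t ^ (-(0 : ℝ)) := by
  refine Asymptotics.IsBigO.of_bound 1 ?_
  filter_upwards [Ioc_mem_nhdsGT (zero_lt_one' ℝ)] with t ht
  rw [auxF_eq ht, norm_neg, Complex.norm_real, Real.norm_of_nonneg (phiK_nonneg ht.1)]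
  simpa using phiK_le_one ht.1

lemma mellin_bose {s : ℂ} (hs : 1 < s.re) :
    mellin (fun t : ℝ => (((Real.exp t - 1)⁻¹ : ℝ) : ℂ)) s = Gamma s * riemannZeta s := by
  have h := hasSum_mellin (a := fun _ : ℕ => (1 : ℂ)) (p := fun n : ℕ => (n + 1 : ℝ))
    (F := fun t : ℝ => (((Real.exp t - 1)⁻¹ : ℝ) : ℂ)) (s := s)
    (fun i => Or.inr (by positivity)) (by linarith) ?_ ?_
  · rw [← h.tsum_eq, zeta_eq_tsum_one_div_nat_add_one_cpow hs, ← tsum_mul_left]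
    refine tsum_congr fun n => ?_
    push_cast
    ring
  · intro t ht
    have hlt : Real.exp (-t) < 1 := by simpa using ht
    have hg := (hasSum_geometric_of_lt_one (Real.exp_pos (-t)).le hlt).mul_left (Real.exp (-t))
    have e : Real.exp (-t) * (1 - Real.exp (-t))⁻¹ = (Real.exp t - 1)⁻¹ := by
      have h1 := exp_sub_one_pos' ht
      have h2 : 1 - Real.exp (-t) ≠ 0 := by linarith
      rw [Real.exp_neg] at *
      have h3 := Real.exp_pos t
      field_simp
    rw [e] at hg
    have := Complex.hasSum_ofReal.2 hg
    convert! this using 1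
    ext n
    rw [one_mul, ← Real.exp_nat_mul, ← Real.exp_add]
    congr 2
    ring
  · have := (Real.summable_one_div_nat_add_rpow 1 s.re).2 hs
    refine this.congr fun n => ?_
    rw [norm_one, abs_of_nonneg (by positivity)]

lemma mellin_auxF {s : ℂ} (hs : 1 < s.re) :
    mellin auxF s = Gamma s * riemannZeta s - 1 / (s - 1) := by
  have h1 := hasMellin_cpow_Ioc (-1) (s := s) (by simpa using hs)
  have h0 : MellinConvergent auxF s :=
    mellinConvergent_of_isBigO_rpow_exp one_pos locInt_auxF auxF_top auxF_bot (by linarith)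
  have h2 := (hasMellin_add h0 h1.1).2
  have : (fun t => auxF t + indicator (Ioc 0 1) (fun t : ℝ => (t : ℂ) ^ (-1 : ℂ)) t) =
    (fun t : ℝ => (((Real.exp t - 1)⁻¹ : ℝ) : ℂ)) := by
    ext t
    simp [auxF]
  rw [this, mellin_bose hs, h1.2] at h2
  rw [h2]
  ring

lemma mellin_auxF' {s : ℂ} (hs : 0 < s.re) :
    (s - 1) * mellin auxF s + 1 = Gamma s * riemannZeta₁ s := by
  have hU : IsOpen {s : ℂ | 0 < s.re} := isOpen_lt continuous_const Complex.continuous_re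
  have hf : AnalyticOnNhd ℂ (fun s => (s - 1) * mellin auxF s + 1) {s : ℂ | 0 < s.re} := by
    refine DifferentiableOn.analyticOnNhd (fun s hs => ?_) hU
    have := mellin_differentiableAt_of_isBigO_rpow_exp one_pos locInt_auxF auxF_top auxF_bot hs
    exact DifferentiableAt.differentiableWithinAt (by fun_prop)
  have hg : AnalyticOnNhd ℂ (fun s => Gamma s * riemannZeta₁ s) {s : ℂ | 0 < s.re} := by
    refine DifferentiableOn.analyticOnNhd (fun s hs => ?_) hU
    have : DifferentiableAt ℂ Gamma s := by
      refine differentiableAt_Gamma _ fun m h => ?_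
      have h2 := congrArg Complex.re h
      simp only [neg_re, natCast_re] at h2
      have : (0 : ℝ) ≤ m := m.cast_nonneg
      simp only [mem_ofPred_eq] at hs
      linarith
    have h2 := differentiable_riemannZeta₁ s
    exact DifferentiableAt.differentiableWithinAt (this.mul h2)
  refine hf.eqOn_of_preconnected_of_eventuallyEq hg
    (convex_halfSpace_re_gt 0).isPreconnected (z₀ := 2) (by simp) ?_ hs
  have : {s : ℂ | 1 < s.re} ∈ nhds (2 : ℂ) :=
    (isOpen_lt continuous_const Complex.continuous_re).mem_nhds (by simp)
  filter_upwards [this] with s hs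
  have h1 : s ≠ 1 := by rintro rfl; simp at hs
  have h2 : s - 1 ≠ 0 := sub_ne_zero.2 h1
  rw [mellin_auxF hs, riemannZeta_eq_inv_sub_mul h1]
  field_simp
  ring

lemma mellin_phiK {s : ℂ} (h₀ : 0 < s.re) (h₁ : s.re < 1) :
    HasMellin (fun t => (phiK t : ℂ)) s (-(Gamma s * riemannZeta s)) := by
  have h1 : s ≠ 1 := by rintro rfl; simp at h₁
  have h2 : s - 1 ≠ 0 := sub_ne_zero.2 h1
  have h0 : MellinConvergent auxF s :=
    mellinConvergent_of_isBigO_rpow_exp one_pos locInt_auxF auxF_top auxF_bot h₀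
  have ha : (s - 2).re < -1 := by simp; linarith
  have hsm : ∀ t : ℝ, (t : ℂ) ^ (s - 1) • indicator (Ioi 1) (fun t : ℝ => (t : ℂ) ^ (-1 : ℂ)) t =
      indicator (Ioi 1) (fun t : ℝ => (t : ℂ) ^ (s - 2)) t := by
    intro t
    by_cases ht : t ∈ Ioi (1 : ℝ)
    · have : (t : ℂ) ≠ 0 := by
        have : (1 : ℝ) < t := ht
        exact_mod_cast (by linarith : (0 : ℝ) < t).ne'
      rw [indicator_of_mem ht, indicator_of_mem ht, smul_eq_mul, ← cpow_add _ _ this]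
      congr 1
      ring
    · rw [indicator_of_notMem ht, indicator_of_notMem ht, smul_zero]
  have hI : HasMellin (indicator (Ioi 1) (fun t : ℝ => (t : ℂ) ^ (-1 : ℂ))) s (-1 / (s - 1)) := by
    unfold HasMellin MellinConvergent mellin
    simp_rw [hsm]
    constructor
    · exact ((integrableOn_Ioi_cpow_of_lt ha one_pos).integrable_indicator
        measurableSet_Ioi).integrableOn
    · rw [setIntegral_indicator measurableSet_Ioi, inter_eq_self_of_subset_right
        (Ioi_subset_Ioi zero_le_one), integral_Ioi_cpow_of_lt ha one_pos]
      simp only [ofReal_one, one_cpow]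
      congr 1
      ring
  have h3 := hasMellin_sub hI.1 h0
  have hc : ∀ t ∈ Ioi (0 : ℝ), (t : ℂ) ^ (s - 1) •
      (indicator (Ioi 1) (fun t : ℝ => (t : ℂ) ^ (-1 : ℂ)) t - auxF t)
      = (t : ℂ) ^ (s - 1) • (phiK t : ℂ) := by
    intro t ht
    congr 1
    by_cases h : t ≤ 1
    · rw [auxF_eq ⟨ht, h⟩, indicator_of_notMem (by simpa using h)]
      simp
    · have hn : t ∉ Ioc (0 : ℝ) 1 := fun h' => h h'.2
      have hm : t ∈ Ioi (1 : ℝ) := not_le.1 h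
      simp only [auxF, indicator_of_notMem hn, indicator_of_mem hm, phiK, cpow_neg_one]
      push_cast
      ring
  refine ⟨h3.1.congr_fun hc measurableSet_Ioi, ?_⟩
  have h4 := h3.2
  have h5 := mellin_auxF' h₀
  rw [hI.2] at h4
  rw [riemannZeta_eq_inv_sub_mul h1, ← mul_assoc, mul_comm (Gamma s), mul_assoc, ← h5]
  unfold mellin at h4 ⊢
  rw [← setIntegral_congr_fun measurableSet_Ioi hc, h4]
  field_simp
  ring

lemma integral_cpow_exp {z : ℂ} (h₁ : z.re < 1) {t : ℝ} (ht : 0 < t) :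
    IntegrableOn (fun x : ℝ => (x : ℂ) ^ (-z) * Complex.exp (-(t * x))) (Ioi 0) ∧
    ∫ x in Ioi (0 : ℝ), (x : ℂ) ^ (-z) * Complex.exp (-(t * x)) =
      (t : ℂ) ^ (z - 1) * Gamma (1 - z) := by
  have hre : 0 < (1 - z).re := by simpa using h₁
  have htc : (t : ℂ) ≠ 0 := by exact_mod_cast ht.ne'
  have h := Complex.integral_cpow_mul_exp_neg_mul_Ioi (a := 1 - z) (r := t) hre
    (by exact_mod_cast ht)
  have e : (1 / (t : ℂ)) ^ (1 - z) = (t : ℂ) ^ (z - 1) := by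
    rw [one_div, inv_cpow _ _ (by rw [arg_ofReal_of_nonneg ht.le]; exact Real.pi_pos.ne),
      ← cpow_neg, neg_sub]
  rw [e, show 1 - z - 1 = -z by ring] at h
  refine ⟨?_, h⟩
  by_contra hc
  have h0 := integral_undef hc
  rw [h0] at h
  exact mul_ne_zero (by simp [cpow_eq_zero_iff, htc]) (Gamma_ne_zero_of_re_pos hre) h.symm

lemma measurable_phiK : Measurable phiK := by
  unfold phiK
  fun_prop

noncomputable def kerK (z : ℂ) (p : ℝ × ℝ) : ℂ :=
  (phiK p.2 : ℂ) * ((p.1 : ℂ) ^ (-z) * Complex.exp (-(p.2 * p.1)))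

lemma integrable_kerK {z : ℂ} (h₀ : 0 < z.re) (h₁ : z.re < 1) :
    Integrable (kerK z) ((volume.restrict (Ioi (0 : ℝ))).prod (volume.restrict (Ioi (0 : ℝ)))) := by
  have hm : Measurable (kerK z) := by
    unfold kerK
    have := measurable_phiK
    fun_prop
  rw [integrable_prod_iff' hm.aestronglyMeasurable]
  constructor
  · filter_upwards [ae_restrict_mem measurableSet_Ioi] with t ht
    exact (integral_cpow_exp h₁ ht).1.const_mul (phiK t : ℂ)
  · have h2 := (mellin_phiK h₀ h₁).1.norm.const_mul (Real.Gamma (1 - z.re))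
    refine h2.congr ?_
    filter_upwards [ae_restrict_mem measurableSet_Ioi] with t ht
    have ht' : 0 < t := ht
    have h3 := Real.integral_rpow_mul_exp_neg_mul_Ioi (a := 1 - z.re) (r := t) (by linarith) ht
    have h4 : ∀ x ∈ Ioi (0 : ℝ), ‖kerK z (x, t)‖ =
        phiK t * (x ^ (1 - z.re - 1) * Real.exp (-(t * x))) := by
      intro x hx
      simp only [kerK]
      rw [norm_mul, norm_mul, Complex.norm_real, Real.norm_of_nonneg (phiK_nonneg ht),
        norm_cpow_eq_rpow_re_of_pos hx, Complex.norm_exp]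
      congr 3
      · simp
      · simp
    rw [setIntegral_congr_fun measurableSet_Ioi h4, integral_const_mul, h3, norm_smul,
      norm_cpow_eq_rpow_re_of_pos ht', Complex.norm_real, Real.norm_of_nonneg (phiK_nonneg ht),
      one_div, Real.inv_rpow ht'.le, ← Real.rpow_neg ht'.le]
    simp only [sub_re, one_re, neg_sub]
    ring

lemma integral_kerK_right (z : ℂ) {x : ℝ} (hx : 0 < x) :
    ∫ t in Ioi (0 : ℝ), kerK z (x, t) = (digD x : ℂ) * (x : ℂ) ^ (-z) := by
  rw [digD_eq_lapG hx, lapG, ← integral_complex_ofReal, ← integral_mul_const]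
  refine setIntegral_congr_fun measurableSet_Ioi fun t _ => ?_
  simp only [kerK]
  push_cast
  rw [show -((t : ℂ) * x) = -x * t by ring]
  ring

/-- Representation of `ζ` on the critical strip as a Mellin-type transform of
the digamma remainder `ψ(1+x) − ln x`
(Formula (2) of the paper's Example 3.26.2). -/
theorem zeta_digamma_mellin_repr (z : ℂ) (h₀ : 0 < z.re) (h₁ : z.re < 1) :
    IntegrableOn
      (fun x : ℝ =>
        ((deriv Real.Gamma (1 + x) / Real.Gamma (1 + x) - Real.log x : ℝ) : ℂ)
          * (x : ℂ) ^ (-z))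
      (Ioi 0) ∧
    riemannZeta z =
      -(Complex.sin (Real.pi * z) / (Real.pi : ℂ)) *
        ∫ x in Ioi (0 : ℝ),
          ((deriv Real.Gamma (1 + x) / Real.Gamma (1 + x) - Real.log x : ℝ) : ℂ)
            * (x : ℂ) ^ (-z) := by
  have hK := integrable_kerK h₀ h₁
  constructor
  · refine hK.integral_prod_left.congr ?_
    filter_upwards [ae_restrict_mem measurableSet_Ioi] with x hx
    exact integral_kerK_right z hx
  · have h1 : ∫ x in Ioi (0 : ℝ),
          ((deriv Real.Gamma (1 + x) / Real.Gamma (1 + x) - Real.log x : ℝ) : ℂ)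
            * (x : ℂ) ^ (-z) = Gamma (1 - z) * -(Gamma z * riemannZeta z) := by
      rw [← (mellin_phiK h₀ h₁).2, mellin, ← integral_const_mul]
      have h5 : ∀ x ∈ Ioi (0 : ℝ), ((deriv Real.Gamma (1 + x) / Real.Gamma (1 + x)
          - Real.log x : ℝ) : ℂ) * (x : ℂ) ^ (-z) = ∫ t in Ioi (0 : ℝ), kerK z (x, t) :=
        fun x hx => (integral_kerK_right z hx).symm
      rw [setIntegral_congr_fun measurableSet_Ioi h5,
        integral_integral_swap (f := fun x t => kerK z (x, t)) hK]
      refine setIntegral_congr_fun measurableSet_Ioi fun t ht => ?_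
      simp only [kerK]
      rw [integral_const_mul, (integral_cpow_exp h₁ ht).2, smul_eq_mul]
      ring
    have h2 := Complex.Gamma_mul_Gamma_one_sub z
    have hpi : (Real.pi : ℂ) ≠ 0 := by exact_mod_cast Real.pi_ne_zero
    have hG : Gamma z * Gamma (1 - z) ≠ 0 := mul_ne_zero (Gamma_ne_zero_of_re_pos h₀)
      (Gamma_ne_zero_of_re_pos (by simpa using h₁))
    have hs : Complex.sin (Real.pi * z) ≠ 0 := by
      intro h
      rw [h, div_zero] at h2
      exact hG h2
    rw [h1, show Gamma (1 - z) * -(Gamma z * riemannZeta z) =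
      -((Gamma z * Gamma (1 - z)) * riemannZeta z) by ring, h2]
    field_simp
end
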